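/- Let V be a finite-dimensional real inner product space of dimension 2m and ω ∈ Λ²V* a 2-form whose matrix in some orthonormal basis is the standard symplectic matrix [[0, I],[−I, 0]]. Then for every i < m, the map L^{m−i} : Λ^i V* → Λ^{2m−i} V*, α ↦ ω^{m−i} ∧ α, is a linear isomorphism; in particular L : α ↦ ω ∧ α is injective on Λ^i V* for i < m. -/

import Mathlib

open ExteriorAlgebra Module

namespace ExteriorAlgebra

open CliffordAlgebra (contractLeft contractLeft_ι_mul contractLeft_algebraMap)

section CommRing

variable {R W : Type*} [CommRing R] [AddCommGroup W] [Module R W]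

/-- Every statement about `⋀[R]^(n + 1) W` that is additive may be checked on products `v ∧ y`. -/
theorem exteriorPower_succ_induction {n : ℕ} {p : ExteriorAlgebra R W → Prop}
    (h_mul : ∀ v, ∀ y ∈ ⋀[R]^n W, p (ι R v * y)) (h_add : ∀ x y, p x → p y → p (x + y))
    {x : ExteriorAlgebra R W} (hx : x ∈ ⋀[R]^(n + 1) W) : p x := by
  rw [exteriorPower, pow_succ'] at hx
  refine Submodule.mul_induction_on hx ?_ h_add
  rintro _ ⟨v, rfl⟩ y hy
  exact h_mul v y hy

theorem contractLeft_eq_zero_of_mem_zero (d : Dual R W) {x : ExteriorAlgebra R W}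
    (hx : x ∈ ⋀[R]^0 W) : contractLeft d x = 0 := by
  rw [exteriorPower, pow_zero] at hx
  obtain ⟨r, rfl⟩ := Submodule.mem_one.mp hx
  exact contractLeft_algebraMap 0 d r

theorem contractLeft_mem (d : Dual R W) {n : ℕ} {x : ExteriorAlgebra R W}
    (hx : x ∈ ⋀[R]^(n + 1) W) : contractLeft d x ∈ ⋀[R]^n W := by
  induction n generalizing x with
  | zero =>
    refine exteriorPower_succ_induction (p := fun x => contractLeft d x ∈ ⋀[R]^0 W)
      (fun v y hy => ?_) (fun x y hx hy => ?_) hx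
    · rw [ι, contractLeft_ι_mul, contractLeft_eq_zero_of_mem_zero d hy, mul_zero, sub_zero]
      exact Submodule.smul_mem _ _ hy
    · rw [map_add]
      exact add_mem hx hy
  | succ n ih =>
    refine exteriorPower_succ_induction (p := fun x => contractLeft d x ∈ ⋀[R]^(n + 1) W)
      (fun v y hy => ?_) (fun x y hx hy => ?_) hx
    · rw [ι, contractLeft_ι_mul]
      refine sub_mem (Submodule.smul_mem _ _ hy) ?_
      rw [exteriorPower, pow_succ']
      exact Submodule.mul_mem_mul ⟨v, rfl⟩ (ih hy)
    · rw [map_add]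
      exact add_mem hx hy

/-- The Euler identity: `∑ eₐ ∧ (eₐ^* ⌟ x)` is the degree operator. -/
theorem sum_ι_mul_contractLeft_coord {κ : Type*} [Fintype κ] (e : Basis κ R W) {n : ℕ}
    {x : ExteriorAlgebra R W} (hx : x ∈ ⋀[R]^n W) :
    ∑ a, ι R (e a) * contractLeft (e.coord a) x = (n : R) • x := by
  induction n generalizing x with
  | zero => simp [contractLeft_eq_zero_of_mem_zero _ hx]
  | succ n ih =>
    refine exteriorPower_succ_induction (p := fun x =>
      ∑ a, ι R (e a) * contractLeft (e.coord a) x = ((n + 1 : ℕ) : R) • x)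
      (fun v y hy => ?_) (fun x y hx hy => ?_) hx
    · have swap (a : κ) : ι R (e a) * contractLeft (e.coord a) (ι R v * y) =
          ι R (e.repr v a • e a) * y + ι R v * (ι R (e a) * contractLeft (e.coord a) y) := by
        rw [ι, contractLeft_ι_mul, mul_sub, ← mul_assoc, ← mul_assoc,
          eq_neg_of_add_eq_zero_left (ι_add_mul_swap (e a) v)]
        simp [sub_eq_add_neg]
      simp_rw [swap]
      rw [Finset.sum_add_distrib, ← Finset.sum_mul, ← map_sum, e.sum_repr, ← Finset.mul_sum, ih hy]
      rw [mul_smul_comm, Nat.cast_succ, add_smul, one_smul, add_comm]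
    · simp only [map_add, mul_add, Finset.sum_add_distrib, smul_add, hx, hy]

variable {m : ℕ} (e : Basis (Fin (m + m)) R W)

/-- The standard symplectic form `∑ⱼ eⱼ ∧ e_{m+j}` of a basis `e`. -/
noncomputable def symplecticForm : ExteriorAlgebra R W :=
  ∑ j : Fin m, ι R (e (Fin.castAdd m j)) * ι R (e (Fin.natAdd m j))

/-- The dual Lefschetz operator: contraction with the bivector dual to `symplecticForm e`. -/
noncomputable def dualLefschetz : ExteriorAlgebra R W →ₗ[R] ExteriorAlgebra R W :=
  ∑ j : Fin m, contractLeft (e.coord (Fin.natAdd m j)) ∘ₗ contractLeft (e.coord (Fin.castAdd m j))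

theorem symplecticForm_mem : symplecticForm e ∈ ⋀[R]^2 W := by
  refine sum_mem fun j _ => ?_
  rw [exteriorPower, pow_two]
  exact Submodule.mul_mem_mul ⟨_, rfl⟩ ⟨_, rfl⟩

theorem symplecticForm_pow_mul_mem (r : ℕ) {n : ℕ} {x : ExteriorAlgebra R W}
    (hx : x ∈ ⋀[R]^n W) : symplecticForm e ^ r * x ∈ ⋀[R]^(2 * r + n) W := by
  rw [exteriorPower, pow_add, pow_mul]
  exact Submodule.mul_mem_mul (Submodule.pow_mem_pow _ (symplecticForm_mem e) r) hx

theorem dualLefschetz_mem {n : ℕ} {x : ExteriorAlgebra R W} (hx : x ∈ ⋀[R]^(n + 2) W) :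
    dualLefschetz e x ∈ ⋀[R]^n W := by
  rw [dualLefschetz, LinearMap.sum_apply]
  exact sum_mem fun j _ => contractLeft_mem _ (contractLeft_mem _ hx)

theorem dualLefschetz_eq_zero {n : ℕ} (hn : n < 2) {x : ExteriorAlgebra R W}
    (hx : x ∈ ⋀[R]^n W) : dualLefschetz e x = 0 := by
  rw [dualLefschetz, LinearMap.sum_apply]
  refine Finset.sum_eq_zero fun j _ => ?_
  rw [LinearMap.comp_apply]
  interval_cases n
  · rw [contractLeft_eq_zero_of_mem_zero _ hx, map_zero]
  · exact contractLeft_eq_zero_of_mem_zero _ (contractLeft_mem _ hx)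

/-- The `𝔰𝔩₂` relation `[Λ, L] = m - deg`. -/
theorem dualLefschetz_symplecticForm_mul {n : ℕ} {x : ExteriorAlgebra R W}
    (hx : x ∈ ⋀[R]^n W) :
    dualLefschetz e (symplecticForm e * x) =
      symplecticForm e * dualLefschetz e x + ((m : R) - n) • x := by
  have key (k j : Fin m) :
      contractLeft (e.coord (Fin.natAdd m k)) (contractLeft (e.coord (Fin.castAdd m k))
        (ι R (e (Fin.castAdd m j)) * ι R (e (Fin.natAdd m j)) * x)) =
      ι R (e (Fin.castAdd m j)) * ι R (e (Fin.natAdd m j)) *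
        contractLeft (e.coord (Fin.natAdd m k)) (contractLeft (e.coord (Fin.castAdd m k)) x) +
      if j = k then x - ι R (e (Fin.castAdd m k)) * contractLeft (e.coord (Fin.castAdd m k)) x -
        ι R (e (Fin.natAdd m k)) * contractLeft (e.coord (Fin.natAdd m k)) x else 0 := by
    have h₁ : Fin.castAdd m j ≠ Fin.natAdd m k := by simp [Fin.ext_iff]; omega
    have h₂ : Fin.natAdd m j ≠ Fin.castAdd m k := by simp [Fin.ext_iff]; omega
    rw [ι]
    by_cases h : j = k
    · subst h
      simp [mul_assoc, contractLeft_ι_mul, h₁, h₂, -Fin.natAdd_eq_addNat, mul_sub]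
      abel
    · simp [mul_assoc, contractLeft_ι_mul, h₁, h₂, -Fin.natAdd_eq_addNat, h]
  have euler := sum_ι_mul_contractLeft_coord e hx
  rw [Fin.sum_univ_add] at euler
  simp only [dualLefschetz, symplecticForm, LinearMap.sum_apply, LinearMap.comp_apply,
    Finset.sum_mul, map_sum, key, Finset.sum_add_distrib, Finset.mul_sum, Finset.sum_ite_eq,
    Finset.mem_univ, if_true, Finset.sum_sub_distrib, Finset.sum_const,
    Finset.card_univ, Fintype.card_fin]
  rw [sub_sub, euler, sub_smul, Nat.cast_smul_eq_nsmul R m x, Finset.sum_comm]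

theorem dualLefschetz_symplecticForm_pow_mul (r : ℕ) {n : ℕ} {x : ExteriorAlgebra R W}
    (hx : x ∈ ⋀[R]^n W) :
    dualLefschetz e (symplecticForm e ^ (r + 1) * x) =
      symplecticForm e ^ (r + 1) * dualLefschetz e x +
        ((r + 1 : R) * (m - n - r)) • (symplecticForm e ^ r * x) := by
  induction r with
  | zero => simpa using dualLefschetz_symplecticForm_mul e hx
  | succ r ih =>
    rw [pow_succ' _ (r + 1), mul_assoc,
      dualLefschetz_symplecticForm_mul e (symplecticForm_pow_mul_mem e (r + 1) hx), ih, mul_add,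
      ← mul_assoc, mul_smul_comm, ← mul_assoc, ← pow_succ', ← pow_succ', add_assoc,
      ← add_smul]
    congr 2
    push_cast
    ring

end CommRing

section Field

variable {K W : Type*} [Field K] [CharZero K] [AddCommGroup W] [Module K W] {m : ℕ}
  (e : Basis (Fin (m + m)) K W)

theorem eq_zero_of_symplecticForm_pow_mul_eq_zero {r n : ℕ} (h : n + r ≤ m)
    {x : ExteriorAlgebra K W} (hx : x ∈ ⋀[K]^n W) (hr : symplecticForm e ^ r * x = 0) :
    x = 0 := by
  induction n using Nat.strong_induction_on generalizing r x with
  | _ n ihn =>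
  induction r with
  | zero => simpa using hr
  | succ r ihr =>
    have comm := dualLefschetz_symplecticForm_pow_mul e r hx
    rw [hr, map_zero] at comm
    have primitive : dualLefschetz e x = 0 := by
      rcases lt_or_ge n 2 with hn | hn
      · exact dualLefschetz_eq_zero e hn hx
      · obtain ⟨k, rfl⟩ := Nat.exists_eq_add_of_le' hn
        refine ihn k (by omega) (r := r + 2) (by omega) (dualLefschetz_mem e hx) ?_
        have := congrArg (symplecticForm e * ·) comm
        simpa [mul_add, ← mul_assoc, ← pow_succ', hr] using this.symm
    rw [primitive, mul_zero, zero_add, eq_comm, smul_eq_zero] at comm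
    refine ihr (by omega) (comm.resolve_left (mul_ne_zero r.cast_add_one_ne_zero ?_))
    rw [sub_sub, sub_ne_zero]
    exact_mod_cast (show m ≠ n + r by omega)

/-- Hard Lefschetz: multiplication by `ω ^ r` as an isomorphism `Λⁿ W ≃ Λ²ᵐ⁻ⁿ W`. -/
theorem exists_lefschetzEquiv {n : ℕ} (hn : n ≤ m) :
    ∃ f : ⋀[K]^n W ≃ₗ[K] ⋀[K]^(m + m - n) W,
      ∀ x, (f x : ExteriorAlgebra K W) = symplecticForm e ^ (m - n) * x := by
  have mem (x : ⋀[K]^n W) : symplecticForm e ^ (m - n) * (x : ExteriorAlgebra K W) ∈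
      ⋀[K]^(m + m - n) W := by
    convert symplecticForm_pow_mul_mem e (m - n) x.2 using 2
    omega
  let f : ⋀[K]^n W →ₗ[K] ⋀[K]^(m + m - n) W :=
    (LinearMap.mulLeft K (symplecticForm e ^ (m - n)) ∘ₗ (⋀[K]^n W).subtype).codRestrict _ mem
  have f_inj : Function.Injective f := by
    refine (injective_iff_map_eq_zero f).mpr fun x hx => Subtype.ext ?_
    exact eq_zero_of_symplecticForm_pow_mul_eq_zero e (by omega) x.2 (congrArg Subtype.val hx)
  have : Module.Finite K W := .of_basis e
  have finrank_eq : finrank K (⋀[K]^n W) = finrank K (⋀[K]^(m + m - n) W) := by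
    rw [exteriorPower.finrank_eq, exteriorPower.finrank_eq, finrank_eq_card_basis e,
      Fintype.card_fin, Nat.choose_symm (by omega)]
  exact ⟨LinearEquiv.ofInjectiveOfFinrankEq f f_inj finrank_eq, fun _ => rfl⟩

end Field

end ExteriorAlgebra

/-- linear-algebra hard Lefschetz: let `V` be a real inner product space
of dimension `2m` and let `ω ∈ Λ²V*` be the 2-form whose matrix in (the dual basis of)
an orthonormal basis `b` is the standard symplectic matrix `[[0, I], [-I, 0]]`, i.e.
`ω = Σ_{j=1}^m b_j^* ∧ b_{m+j}^*`.  Then for every `i < m`, wedging with `ω^{m-i}` is a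
linear isomorphism `Λ^i V* → Λ^{2m-i} V*`; in particular `L : α ↦ ω ∧ α` is injective
on `Λ^i V*` for `i < m`. -/
theorem lefschetz_exterior_power
    (m : ℕ) {V : Type*} [NormedAddCommGroup V] [InnerProductSpace ℝ V]
    (b : OrthonormalBasis (Fin (m + m)) ℝ V)
    (ω : ExteriorAlgebra ℝ (Module.Dual ℝ V))
    (hω : ω = ∑ j : Fin m,
      ExteriorAlgebra.ι ℝ (b.toBasis.dualBasis (Fin.castAdd m j)) *
        ExteriorAlgebra.ι ℝ (b.toBasis.dualBasis (Fin.natAdd m j)))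
    (i : ℕ) (hi : i < m) :
    (∃ e : ⋀[ℝ]^i (Module.Dual ℝ V) ≃ₗ[ℝ] ⋀[ℝ]^(m + m - i) (Module.Dual ℝ V),
      ∀ α : ⋀[ℝ]^i (Module.Dual ℝ V),
        (e α : ExteriorAlgebra ℝ (Module.Dual ℝ V)) = ω ^ (m - i) * (α : ExteriorAlgebra ℝ (Module.Dual ℝ V))) ∧
    (∀ α β : ⋀[ℝ]^i (Module.Dual ℝ V),
      ω * (α : ExteriorAlgebra ℝ (Module.Dual ℝ V)) = ω * (β : ExteriorAlgebra ℝ (Module.Dual ℝ V)) →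
        α = β) := by
  obtain rfl : ω = symplecticForm b.toBasis.dualBasis := hω
  obtain ⟨e, he⟩ := exists_lefschetzEquiv b.toBasis.dualBasis hi.le
  refine ⟨⟨e, he⟩, fun α β h => e.injective (Subtype.ext ?_)⟩
  obtain ⟨k, hk⟩ := Nat.exists_eq_add_of_lt hi
  rw [he, he, show m - i = k + 1 by omega, pow_succ, mul_assoc, h, mul_assoc]
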